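/- arXiv:2312.15680 — 3 statements merged into one kernel-verified Lean document; each statement's English description precedes it below -/
import Mathlib

section
/- Let R be a commutative ring, n ≥ 1, κ = (κ₁,…,κ_n) a list of positive integers with N = κ₁+⋯+κ_n, y₁,…,y_n ∈ R, and λ a partition of length ≤ N. Then det G_λ(y,κ) = det J_λ(y^[κ]) · det G_∅(y,κ); equivalently, when R is a field and y₁,…,y_n are pairwise distinct, the Schur polynomial evaluated at the repeated variables satisfies s_λ(y^[κ]) = det G_λ(y,κ) / det G_∅(y,κ). -/
open scoped BigOperators

/-- Complete homogeneous polynomial of degree `m` evaluated at the list `l`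
(`h₀ = 1`, `h_m = 0` for `m < 0`). -/
def homEval {R : Type*} [CommRing R] (l : List R) (m : ℤ) : R :=
  if 0 ≤ m then
    ∑ f ∈ Finset.Nat.antidiagonalTuple l.length m.toNat, ∏ i, l.get i ^ f i
  else 0

/-- Elementary symmetric polynomial of degree `k` evaluated at the list `l`. -/
def esymmEval {R : Type*} [CommRing R] (l : List R) (k : ℕ) : R :=
  (((l : Multiset R).powersetCard k).map Multiset.prod).sum

/-- Power sum of degree `s` evaluated at the list `l`. -/
def psumEval {R : Type*} [CommRing R] (l : List R) (s : ℕ) : R :=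
  (l.map (· ^ s)).sum

/-- The list `y^[κ]`: `y q` repeated `κ q` times, in order. -/
def repList {R : Type*} {n : ℕ} (y : Fin n → R) (κ : Fin n → ℕ) : List R :=
  (List.ofFn fun q => List.replicate (κ q) (y q)).flatten

/-- Zero-based version of `γ(κ, p) = (q, r)`: the `p`-th entry (0-based) of the list
    `(0,0),…,(0,κ₀−1),(1,0),…,(1,κ₁−1),…`. -/
def gammaPair (n : ℕ) (κ : Fin n → ℕ) (p : ℕ) : ℕ × ℕ :=
  ((List.ofFn fun q : Fin n => (List.range (κ q)).map fun r => ((q : ℕ), r)).flatten).getD p (0, 0)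

/-- The generalized confluent Vandermonde matrix `G_λ(y, κ)` (zero-based indices):
`G[j,p] = binom(N+λ_j−j−1, r) · y_q^(N+λ_j−j−r−1)` if the exponent is `≥ 0`, else `0`,
where `(q, r) = gammaPair n κ p`. -/
def vanG (R : Type*) [CommRing R] {n : ℕ} (N : ℕ) (κ : Fin n → ℕ) (y : Fin n → R)
    (lam : Fin N → ℕ) : Matrix (Fin N) (Fin N) R :=
  Matrix.of fun j p =>
    if h : (gammaPair n κ (p : ℕ)).1 < n ∧
        (j : ℕ) + (gammaPair n κ (p : ℕ)).2 + 1 ≤ N + lam j then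
      (Nat.choose (N + lam j - ((j : ℕ) + 1)) (gammaPair n κ (p : ℕ)).2 : R) *
        y ⟨(gammaPair n κ (p : ℕ)).1, h.1⟩ ^
          (N + lam j - ((j : ℕ) + (gammaPair n κ (p : ℕ)).2 + 1))
    else 0

/-- The Jacobi–Trudi matrix `J_λ(x) = [h_{λ_j − j + k}(x)]`. -/
def jacobiTrudi (R : Type*) [CommRing R] (N : ℕ) (lam : Fin N → ℕ) (x : List R) :
    Matrix (Fin N) (Fin N) R :=
  Matrix.of fun j k => homEval x ((lam j : ℤ) - (j : ℕ) + (k : ℕ))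

/-- The matrix `M(y, κ)` with entries `(−1)^{N−k−r+1} e_{N−k−r+1}(y^[κ − r b_q])`
(in one-based form); entries with `N−k−r+1 < 0` are `0`. -/
def matM (R : Type*) [CommRing R] {n : ℕ} (N : ℕ) (κ : Fin n → ℕ) (y : Fin n → R) :
    Matrix (Fin N) (Fin N) R :=
  Matrix.of fun k p =>
    if h : (gammaPair n κ (p : ℕ)).1 < n ∧
        (k : ℕ) + (gammaPair n κ (p : ℕ)).2 + 1 ≤ N then
      (-1 : R) ^ (N - ((k : ℕ) + (gammaPair n κ (p : ℕ)).2 + 1)) *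
        esymmEval
          (repList y (Function.update κ ⟨(gammaPair n κ (p : ℕ)).1, h.1⟩
            (κ ⟨(gammaPair n κ (p : ℕ)).1, h.1⟩ - ((gammaPair n κ (p : ℕ)).2 + 1))))
          (N - ((k : ℕ) + (gammaPair n κ (p : ℕ)).2 + 1))
    else 0

/-- The column vector `H^N_{s,λ}(l) = (h_{s + λ_j − j}(l))_{j=1}^N` (one-based `j`). -/
def Hcol {R : Type*} [CommRing R] {N : ℕ} (lam : Fin N → ℕ) (s : ℕ) (l : List R) :
    Fin N → R :=
  fun j => homEval l ((s : ℤ) + lam j - ((j : ℕ) + 1))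

theorem sum_antidiagonalTuple_succ {M : Type*} [AddCommMonoid M] (k n : ℕ)
    (g : (Fin (k + 1) → ℕ) → M) :
    ∑ f ∈ Finset.Nat.antidiagonalTuple (k + 1) n, g f =
      ∑ p ∈ Finset.HasAntidiagonal.antidiagonal n, ∑ f ∈ Finset.Nat.antidiagonalTuple k p.2,
        g (Fin.cons p.1 f) := by
  rw [Finset.sum_sigma']
  symm
  refine Finset.sum_bij'
    (fun x _ => (Fin.cons x.1.1 x.2 : Fin (k + 1) → ℕ))
    (fun f _ => ⟨(f 0, ∑ i, Fin.tail f i), Fin.tail f⟩) ?_ ?_ ?_ ?_ ?_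
  · rintro ⟨⟨a, b⟩, f⟩ h
    simp only [Finset.mem_sigma, Finset.HasAntidiagonal.mem_antidiagonal,
      Finset.Nat.mem_antidiagonalTuple] at h
    rw [Finset.Nat.mem_antidiagonalTuple, Fin.sum_cons, h.2, h.1]
  · intro f h
    rw [Finset.Nat.mem_antidiagonalTuple, Fin.sum_univ_succ] at h
    simp only [Finset.mem_sigma, Finset.HasAntidiagonal.mem_antidiagonal,
      Finset.Nat.mem_antidiagonalTuple, and_true]
    exact h
  · rintro ⟨⟨a, b⟩, f⟩ h
    simp only [Finset.mem_sigma, Finset.HasAntidiagonal.mem_antidiagonal,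
      Finset.Nat.mem_antidiagonalTuple] at h
    obtain ⟨-, rfl⟩ := h
    simp
  · intro f _
    exact Fin.cons_self_tail f
  · intros
    rfl

theorem homEval_natCast {R : Type*} [CommRing R] (l : List R) (m : ℕ) :
    homEval l m = ∑ f ∈ Finset.Nat.antidiagonalTuple l.length m, ∏ i, l.get i ^ f i := by
  simp [homEval]

theorem homEval_of_neg {R : Type*} [CommRing R] (l : List R) {m : ℤ} (hm : m < 0) :
    homEval l m = 0 := by
  simp [homEval, not_le.2 hm]

theorem homEval_zero {R : Type*} [CommRing R] (l : List R) : homEval l 0 = 1 := by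
  simp [homEval, Finset.Nat.antidiagonalTuple_zero_right]

theorem homEval_cons {R : Type*} [CommRing R] (x : R) (l : List R) (m : ℕ) :
    homEval (x :: l) m = ∑ p ∈ Finset.HasAntidiagonal.antidiagonal m, x ^ p.1 * homEval l p.2 := by
  simp only [homEval_natCast]
  refine (sum_antidiagonalTuple_succ l.length m
    fun f => ∏ i : Fin (l.length + 1), (x :: l).get i ^ f i).trans ?_
  refine Finset.sum_congr rfl fun p _ => ?_
  rw [Finset.mul_sum]
  refine Finset.sum_congr rfl fun f _ => ?_
  rw [Fin.prod_univ_succ]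
  simp

theorem mk_pow_mul_one_sub {R : Type*} [CommRing R] (x : R) :
    PowerSeries.mk (fun m => x ^ m) * (1 - PowerSeries.C x * PowerSeries.X) = 1 := by
  ext m
  cases m with
  | zero => simp [mul_sub]
  | succ m =>
    rw [mul_sub, mul_left_comm, ← mul_assoc, mul_one, map_sub, PowerSeries.coeff_succ_mul_X]
    simp [PowerSeries.coeff_one, pow_succ']

/-- The generating function of the complete homogeneous polynomials. -/
theorem mk_homEval_mul_prod {R : Type*} [CommRing R] (l : List R) :
    PowerSeries.mk (fun m => homEval l m) *
      (l.map fun x => 1 - PowerSeries.C x * PowerSeries.X).prod = 1 := by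
  induction l with
  | nil =>
    ext m
    cases m with
    | zero => simp [homEval_zero]
    | succ m =>
      rw [List.map_nil, List.prod_nil, mul_one, PowerSeries.coeff_mk, homEval_natCast]
      simp [PowerSeries.coeff_one]
  | cons x l ih =>
    have h : PowerSeries.mk (fun m => homEval (x :: l) m) =
        PowerSeries.mk (fun m => x ^ m) * PowerSeries.mk (fun m => homEval l m) := by
      ext m
      simp [PowerSeries.coeff_mul, homEval_cons]
    rw [h, List.map_cons, List.prod_cons, mul_mul_mul_comm, ih, mk_pow_mul_one_sub, mul_one]

theorem mk_choose_mul_pow_mul_one_sub_pow {R : Type*} [CommRing R] (y : R) (r : ℕ) :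
    PowerSeries.mk (fun m => (m.choose r : R) * y ^ (m - r)) *
      (1 - PowerSeries.C y * PowerSeries.X) ^ (r + 1) = PowerSeries.X ^ r := by
  induction r with
  | zero => simpa using mk_pow_mul_one_sub y
  | succ r ih =>
    have h : PowerSeries.mk (fun m => (m.choose (r + 1) : R) * y ^ (m - (r + 1))) *
        (1 - PowerSeries.C y * PowerSeries.X) =
        PowerSeries.mk (fun m => (m.choose r : R) * y ^ (m - r)) * PowerSeries.X := by
      ext m
      cases m with
      | zero => simp [mul_sub]
      | succ m =>
        rw [mul_sub, mul_left_comm, ← mul_assoc, mul_one, map_sub, PowerSeries.coeff_succ_mul_X,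
          PowerSeries.coeff_succ_mul_X]
        simp only [PowerSeries.coeff_mk, PowerSeries.coeff_C_mul, Nat.choose_succ_succ,
          Nat.cast_add, Nat.add_sub_add_right]
        rcases lt_or_ge m (r + 1) with hm | hm
        · simp [Nat.choose_eq_zero_of_lt hm]
        · obtain ⟨d, rfl⟩ := Nat.exists_eq_add_of_le hm
          rw [show r + 1 + d - r = d + 1 by omega, show r + 1 + d - (r + 1) = d by omega]
          ring
    rw [pow_succ', ← mul_assoc, h, mul_right_comm, ih, pow_succ]

theorem prod_map_repList {R M : Type*} [CommMonoid M] {n : ℕ} (y : Fin n → R) (κ : Fin n → ℕ)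
    (f : R → M) : ((repList y κ).map f).prod = ∏ q, f (y q) ^ κ q := by
  simp [repList, List.map_flatten, List.prod_flatten, List.map_ofFn, List.prod_ofFn,
    Function.comp_def]

theorem gammaPair_spec {n : ℕ} (κ : Fin n → ℕ) {p : ℕ} (hp : p < ∑ q, κ q) :
    ∃ q : Fin n, (gammaPair n κ p).1 = q ∧ (gammaPair n κ p).2 < κ q := by
  have hlen : p < ((List.ofFn fun q : Fin n =>
      (List.range (κ q)).map fun r => ((q : ℕ), r)).flatten).length := by
    simpa [List.length_flatten, List.map_ofFn, List.sum_ofFn, Function.comp_def] using hp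
  have hmem := List.getElem_mem hlen
  rw [← List.getD_eq_getElem _ (0, 0) hlen] at hmem
  change gammaPair n κ p ∈ _ at hmem
  rw [List.mem_flatten] at hmem
  obtain ⟨L, hL, hmem⟩ := hmem
  rw [List.mem_ofFn] at hL
  obtain ⟨q, rfl⟩ := hL
  rw [List.mem_map] at hmem
  obtain ⟨r, hr, h⟩ := hmem
  exact ⟨q, by rw [← h], by rw [← h]; exact List.mem_range.1 hr⟩

/-- The numerator of the generating function of `m ↦ binom(m, r) y_q^(m-r)` over the common
denominator `∏ (1 - y_q X)^κ_q`. -/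
noncomputable def confluentNumerator {R : Type*} [CommRing R] {n : ℕ} (κ : Fin n → ℕ)
    (y : Fin n → R) (q : Fin n) (r : ℕ) : Polynomial R :=
  Polynomial.X ^ r * ((1 - Polynomial.C (y q) * Polynomial.X) ^ (κ q - (r + 1)) *
    ∏ i ∈ Finset.univ.erase q, (1 - Polynomial.C (y i) * Polynomial.X) ^ κ i)

theorem natDegree_confluentNumerator_lt {R : Type*} [CommRing R] {n : ℕ} (κ : Fin n → ℕ)
    (y : Fin n → R) (q : Fin n) {r : ℕ} (hr : r < κ q) :
    (confluentNumerator κ y q r).natDegree < ∑ i, κ i := by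
  have hlin (i : Fin n) (k : ℕ) :
      ((1 - Polynomial.C (y i) * Polynomial.X) ^ k).natDegree ≤ k := by
    have h : (1 - Polynomial.C (y i) * Polynomial.X).natDegree ≤ 1 := by compute_degree
    simpa using Polynomial.natDegree_pow_le_of_le k h
  have hprod : (∏ i ∈ Finset.univ.erase q,
      (1 - Polynomial.C (y i) * Polynomial.X) ^ κ i).natDegree ≤
      ∑ i ∈ Finset.univ.erase q, κ i :=
    (Polynomial.natDegree_prod_le _ _).trans (Finset.sum_le_sum fun i _ => hlin i _)
  have h : (confluentNumerator κ y q r).natDegree ≤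
      r + (κ q - (r + 1) + ∑ i ∈ Finset.univ.erase q, κ i) :=
    Polynomial.natDegree_mul_le_of_le (Polynomial.natDegree_X_pow_le r)
      (Polynomial.natDegree_mul_le_of_le (hlin q _) hprod)
  rw [← Finset.add_sum_erase _ _ (Finset.mem_univ q)]
  omega

theorem mk_choose_mul_pow_eq_mul_confluentNumerator {R : Type*} [CommRing R] {n : ℕ}
    (κ : Fin n → ℕ) (y : Fin n → R) (q : Fin n) {r : ℕ} (hr : r < κ q) :
    PowerSeries.mk (fun m => (m.choose r : R) * y q ^ (m - r)) =
      PowerSeries.mk (fun m => homEval (repList y κ) m) *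
        (confluentNumerator κ y q r : PowerSeries R) := by
  have hH := mk_homEval_mul_prod (repList y κ)
  rw [prod_map_repList, ← Finset.mul_prod_erase _ _ (Finset.mem_univ q)] at hH
  have hκ : κ q = r + 1 + (κ q - (r + 1)) := by omega
  rw [hκ, pow_add] at hH
  have hQ : (confluentNumerator κ y q r : PowerSeries R) =
      PowerSeries.X ^ r * ((1 - PowerSeries.C (y q) * PowerSeries.X) ^ (κ q - (r + 1)) *
        ∏ i ∈ Finset.univ.erase q, (1 - PowerSeries.C (y i) * PowerSeries.X) ^ κ i) := by
    rw [← Polynomial.coeToPowerSeries.ringHom_apply, confluentNumerator]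
    simp only [map_mul, map_pow, map_prod, map_sub, map_one]
    simp
  rw [hQ, ← mk_choose_mul_pow_mul_one_sub_pow (y q) r]
  linear_combination (-PowerSeries.mk (fun m => (m.choose r : R) * y q ^ (m - r))) * hH

theorem choose_mul_pow_eq_sum_homEval {R : Type*} [CommRing R] {n : ℕ}
    (κ : Fin n → ℕ) (y : Fin n → R) (q : Fin n) {r : ℕ} (hr : r < κ q) (m : ℕ) :
    (m.choose r : R) * y q ^ (m - r) =
      ∑ i ∈ Finset.range (∑ i, κ i),
        homEval (repList y κ) ((m : ℤ) - i) * (confluentNumerator κ y q r).coeff i := by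
  have h := congrArg (PowerSeries.coeff m) (mk_choose_mul_pow_eq_mul_confluentNumerator κ y q hr)
  rw [PowerSeries.coeff_mk, mul_comm (PowerSeries.mk _), PowerSeries.coeff_mul,
    Finset.Nat.sum_antidiagonal_eq_sum_range_succ_mk] at h
  rw [h]
  simp only [Polynomial.coeff_coe, PowerSeries.coeff_mk]
  have hdeg := natDegree_confluentNumerator_lt κ y q hr
  set s := ∑ i, κ i
  have hext (a : ℕ) (ha : a ≤ m + 1 + s)
      (h0 : ∀ i, a ≤ i → homEval (repList y κ) ((m : ℤ) - i) *
        (confluentNumerator κ y q r).coeff i = 0) :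
      ∑ i ∈ Finset.range a, homEval (repList y κ) ((m : ℤ) - i) *
        (confluentNumerator κ y q r).coeff i =
      ∑ i ∈ Finset.range (m + 1 + s), homEval (repList y κ) ((m : ℤ) - i) *
        (confluentNumerator κ y q r).coeff i :=
    Finset.sum_subset (Finset.range_mono ha) fun i _ hi => h0 i (by simpa using hi)
  rw [hext s (by omega) fun i hi => by
      rw [Polynomial.coeff_eq_zero_of_natDegree_lt (by omega), mul_zero],
    ← hext (m + 1) (by omega) fun i hi => by rw [homEval_of_neg _ (by omega), zero_mul]]
  refine Finset.sum_congr rfl fun i hi => ?_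
  rw [Nat.cast_sub (by simpa [Nat.lt_succ_iff] using hi), mul_comm]

/-- The matrix of coefficients of the numerators `confluentNumerator`, which is the right factor
in the factorization of `vanG` through `jacobiTrudi`. -/
noncomputable def numeratorMatrix (R : Type*) [CommRing R] {n : ℕ} (N : ℕ) (κ : Fin n → ℕ)
    (y : Fin n → R) : Matrix (Fin N) (Fin N) R :=
  Matrix.of fun k p =>
    if h : (gammaPair n κ (p : ℕ)).1 < n then
      (confluentNumerator κ y ⟨(gammaPair n κ (p : ℕ)).1, h⟩
        (gammaPair n κ (p : ℕ)).2).coeff (N - 1 - (k : ℕ))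
    else 0

theorem vanG_eq_jacobiTrudi_mul {R : Type*} [CommRing R] {n N : ℕ} (κ : Fin n → ℕ)
    (hN : N = ∑ q, κ q) (y : Fin n → R) (lam : Fin N → ℕ) :
    vanG R N κ y lam = jacobiTrudi R N lam (repList y κ) * numeratorMatrix R N κ y := by
  ext j p
  obtain ⟨q, hq, hr⟩ := gammaPair_spec κ (p.2.trans_eq hN)
  have hlt : (gammaPair n κ p).1 < n := hq ▸ q.2
  have hq' : (⟨(gammaPair n κ p).1, hlt⟩ : Fin n) = q := Fin.ext hq
  have hj := j.2
  have hG : vanG R N κ y lam j p = ((N + lam j - (j + 1)).choose (gammaPair n κ p).2 : R) *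
      y q ^ (N + lam j - (j + 1) - (gammaPair n κ p).2) := by
    simp only [vanG, Matrix.of_apply, hlt, true_and, hq']
    split_ifs with h
    · congr 2
      omega
    · rw [Nat.choose_eq_zero_of_lt (by omega), Nat.cast_zero, zero_mul]
  rw [hG, choose_mul_pow_eq_sum_homEval κ y q hr, ← hN, ← Finset.sum_range_reflect,
    Finset.sum_range, Matrix.mul_apply]
  refine Finset.sum_congr rfl fun k _ => ?_
  simp only [jacobiTrudi, numeratorMatrix, Matrix.of_apply, hlt, dif_pos, hq']
  congr 2
  have hk := k.2
  omega

theorem det_jacobiTrudi_zero {R : Type*} [CommRing R] (N : ℕ) (l : List R) :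
    (jacobiTrudi R N (fun _ => 0) l).det = 1 := by
  rw [Matrix.det_of_isUpperTriangular]
  · simp [jacobiTrudi, homEval_zero]
  · intro j k hkj
    have hkj' : (k : ℕ) < j := hkj
    exact homEval_of_neg l (by push_cast; omega)

/-- `det G_λ(y,κ) = det J_λ(y^[κ]) · det G_∅(y,κ)`, i.e. the bialternant
formula `s_λ(y^[κ]) = det G_λ(y,κ) / det G_∅(y,κ)` for Schur polynomials with
repeated variables. -/
theorem schur_repeated_bialternant {R : Type*} [CommRing R]
    (n : ℕ) (hn : 1 ≤ n) (κ : Fin n → ℕ) (hκ : ∀ q, 0 < κ q)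
    (N : ℕ) (hN : N = ∑ q, κ q) (y : Fin n → R)
    (lam : Fin N → ℕ) (hlam : Antitone lam) :
    (vanG R N κ y lam).det =
      (jacobiTrudi R N lam (repList y κ)).det * (vanG R N κ y fun _ => 0).det := by
  rw [vanG_eq_jacobiTrudi_mul κ hN y lam, vanG_eq_jacobiTrudi_mul κ hN y fun _ => 0,
    Matrix.det_mul, Matrix.det_mul, det_jacobiTrudi_zero, one_mul]
end

section
/- Let R be a commutative ring, n ≥ 1, κ = (κ₁,…,κ_n) positive integers with N = κ₁+⋯+κ_n, and y₁,…,y_n ∈ R. Then the determinant of the confluent Vandermonde matrix satisfies det G_∅(y,κ) = (−1)^{N(N−1)/2} · ∏_{1 ≤ j < k ≤ n} (y_k − y_j)^{κ_j κ_k}. -/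
open scoped BigOperators

open Polynomial

/-- The `r`-th entry of the `q`-th block of a concatenation of blocks `g q 0, …, g q (κ q - 1)`. -/
theorem List.getElem?_flatten_ofFn_map_range {α : Type*} {n : ℕ} (κ : Fin n → ℕ)
    (g : Fin n → ℕ → α) (q : Fin n) (r : ℕ) (hr : r < κ q) :
    ((List.ofFn fun q : Fin n => (List.range (κ q)).map (g q)).flatten)[
      ∑ i : Fin q, κ (Fin.castLE q.2.le i) + r]? = some (g q r) := by
  induction n with
  | zero => exact q.elim0
  | succ n ih =>
    rw [List.ofFn_succ, List.flatten_cons]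
    induction q using Fin.cases with
    | zero =>
      have hsum : ∑ i : Fin (0 : Fin (n + 1)), κ (Fin.castLE (0 : Fin (n + 1)).2.le i) = 0 :=
        Fin.sum_univ_zero _
      rw [hsum, zero_add, List.getElem?_append_left (by simpa using hr)]
      simp [hr]
    | succ q =>
      have hsum : ∑ i : Fin q.succ, κ (Fin.castLE q.succ.2.le i) =
          κ 0 + ∑ i : Fin q, κ (Fin.castLE q.2.le i).succ :=
        Fin.sum_univ_succ (n := q) fun i => κ (Fin.castLE q.succ.2.le i)
      rw [hsum, List.getElem?_append_right (by simp; omega)]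
      convert! ih (fun i => κ i.succ) (fun i => g i.succ) q hr using 2
      simp
      omega

theorem gammaPair_finSigmaFinEquiv {n : ℕ} (κ : Fin n → ℕ) (s : (q : Fin n) × Fin (κ q)) :
    gammaPair n κ (finSigmaFinEquiv s : ℕ) = ((s.1 : ℕ), (s.2 : ℕ)) := by
  rw [gammaPair, finSigmaFinEquiv_apply, List.getD_eq_getElem?_getD,
    List.getElem?_flatten_ofFn_map_range κ (fun q r => ((q : ℕ), r)) s.1 s.2 s.2.2]
  rfl

theorem Fin.sum_Iio_eq_sum_castLE {n : ℕ} {M : Type*} [AddCommMonoid M] (f : Fin n → M)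
    (q : Fin n) : ∑ i ∈ Finset.Iio q, f i = ∑ i : Fin q, f (Fin.castLE q.2.le i) := by
  symm
  refine Finset.sum_nbij (Fin.castLE q.2.le) (fun i _ => ?_) (fun i _ j _ h => ?_)
    (fun i hi => ?_) (fun _ _ => rfl)
  · simp [Fin.lt_def]
  · simpa using h
  · exact ⟨⟨i, by simpa using hi⟩, by simp, rfl⟩

theorem Fin.sign_revPerm (N : ℕ) :
    Equiv.Perm.sign (Fin.revPerm : Equiv.Perm (Fin N)) = (-1) ^ (N * (N - 1) / 2) := by
  rw [Equiv.Perm.sign_eq_prod_prod_Ioi]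
  have h (i : Fin N) : ∏ j ∈ Finset.Ioi i,
      (if Fin.revPerm i < Fin.revPerm j then (1 : ℤˣ) else -1) = (-1) ^ (N - 1 - (i : ℕ)) := by
    rw [← Fin.card_Ioi, ← Finset.prod_const]
    refine Finset.prod_congr rfl fun j hj => if_neg ?_
    simpa using (Finset.mem_Ioi.1 hj).le
  rw [Finset.prod_congr rfl fun i _ => h i, Finset.prod_pow_eq_pow_sum,
    Fin.sum_univ_eq_sum_range fun i => N - 1 - i, Finset.sum_range_reflect (fun i => i) N,
    Finset.sum_range_id]

section Newton

variable {R : Type*} [CommRing R] {n : ℕ} (κ : Fin n → ℕ) (y : Fin n → R)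

/-- The Newton basis polynomial attached to the nodes `y q` with multiplicities `κ q`. -/
noncomputable def confluentNewton (s : (q : Fin n) × Fin (κ q)) : R[X] :=
  (∏ i ∈ Finset.Iio s.1, (X - C (y i)) ^ κ i) * (X - C (y s.1)) ^ (s.2 : ℕ)

theorem confluentNewton_monic (s : (q : Fin n) × Fin (κ q)) : (confluentNewton κ y s).Monic :=
  (monic_prod_of_monic _ _ fun _ _ => (monic_X_sub_C _).pow _).mul ((monic_X_sub_C _).pow _)

theorem confluentNewton_natDegree [Nontrivial R] (s : (q : Fin n) × Fin (κ q)) :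
    (confluentNewton κ y s).natDegree = (finSigmaFinEquiv s : ℕ) := by
  rw [confluentNewton, Monic.natDegree_mul
    (monic_prod_of_monic _ _ fun _ _ => (monic_X_sub_C _).pow _) ((monic_X_sub_C _).pow _),
    natDegree_prod_of_monic _ _ fun _ _ => (monic_X_sub_C _).pow _, finSigmaFinEquiv_apply,
    ← Fin.sum_Iio_eq_sum_castLE]
  simp [(monic_X_sub_C _).natDegree_pow]

theorem taylor_confluentNewton (a : R) (s : (q : Fin n) × Fin (κ q)) :
    taylor a (confluentNewton κ y s) =
      (∏ i ∈ Finset.Iio s.1, (X + C (a - y i)) ^ κ i) * (X + C (a - y s.1)) ^ (s.2 : ℕ) := by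
  have h (b : R) : taylorAlgHom a (X - C b) = X + C (a - b) := by
    simp [taylorAlgHom_apply, add_sub_assoc]
  rw [← taylorAlgHom_apply, confluentNewton, map_mul, map_prod, map_pow, h]
  simp only [map_pow, h]

theorem coeff_taylor_confluentNewton_self (s : (q : Fin n) × Fin (κ q)) :
    (taylor (y s.1) (confluentNewton κ y s)).coeff s.2 =
      ∏ i ∈ Finset.Iio s.1, (y s.1 - y i) ^ κ i := by
  rw [taylor_confluentNewton, sub_self, C_0, add_zero, coeff_mul_X_pow', if_pos le_rfl,
    Nat.sub_self, coeff_zero_eq_eval_zero, eval_prod]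
  simp

theorem coeff_taylor_confluentNewton_of_lt {s t : Σₗ q : Fin n, Fin (κ q)} (h : t < s) :
    (taylor (y (ofLex t).1) (confluentNewton κ y (ofLex s))).coeff (ofLex t).2 = 0 := by
  obtain ⟨q, r⟩ := s
  obtain ⟨q', r'⟩ := t
  change (taylor (y q') (confluentNewton κ y ⟨q, r⟩)).coeff r' = 0
  rw [taylor_confluentNewton]
  rcases Sigma.Lex.lt_def.1 h with h | ⟨h, h'⟩
  · refine X_pow_dvd_iff.1 (Dvd.dvd.mul_right ?_ _) _ r'.2
    have hdvd := Finset.dvd_prod_of_mem (fun i => (X + C (y q' - y i)) ^ κ i) (Finset.mem_Iio.2 h)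
    simpa only [sub_self, C_0, add_zero] using hdvd
  · obtain rfl : q' = q := h
    refine X_pow_dvd_iff.1 (Dvd.dvd.mul_left ?_ _) _ (Fin.lt_def.1 h')
    exact pow_dvd_pow_of_dvd (by simp) _

/-- Hasse derivatives of `f i` at the nodes `y q`, up to order `κ q - 1`. -/
noncomputable def hasseMatrix {ι : Type*} (f : ι → R[X]) : Matrix ι ((q : Fin n) × Fin (κ q)) R :=
  Matrix.of fun i s => (taylor (y s.1) (f i)).coeff s.2

theorem det_hasseMatrix_confluentNewton :
    (hasseMatrix κ y (confluentNewton κ y)).det =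
      ∏ j, ∏ k ∈ Finset.Ioi j, (y k - y j) ^ (κ j * κ k) := by
  have hdet := Matrix.det_of_isUpperTriangular
    (M := (hasseMatrix κ y (confluentNewton κ y)).submatrix
      (ofLex : (Σₗ q : Fin n, Fin (κ q)) ≃ _) ofLex)
    fun _ _ h => coeff_taylor_confluentNewton_of_lt κ y h
  rw [Matrix.det_submatrix_equiv_self] at hdet
  rw [hdet]
  calc ∏ s : Σₗ q : Fin n, Fin (κ q), _
      = ∏ s : (q : Fin n) × Fin (κ q), ∏ i ∈ Finset.Iio s.1, (y s.1 - y i) ^ κ i :=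
        Fintype.prod_equiv ofLex _ _ fun s => coeff_taylor_confluentNewton_self κ y (ofLex s)
    _ = ∏ k, ∏ j ∈ Finset.Iio k, (y k - y j) ^ (κ j * κ k) := by
        simp [Fintype.prod_sigma, Finset.prod_pow, pow_mul]
    _ = _ := Finset.prod_comm' (by simp)

theorem hasseMatrix_eq_mul {N : ℕ} (f : Fin N → R[X]) (hf : ∀ i, (f i).natDegree < N) :
    hasseMatrix κ y f =
      (Matrix.of fun i j : Fin N => (f j).coeff i).transpose *
        hasseMatrix κ y fun i : Fin N => X ^ (i : ℕ) := by
  ext j s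
  simp only [hasseMatrix, Matrix.mul_apply, Matrix.transpose_apply, Matrix.of_apply]
  conv_lhs => rw [(f j).as_sum_range' N (hf j)]
  rw [Finset.sum_range, map_sum, finsetSum_coeff]
  refine Finset.sum_congr rfl fun i _ => ?_
  rw [← C_mul_X_pow_eq_monomial, ← smul_eq_C_mul, map_smul, coeff_smul, smul_eq_mul]

theorem det_hasseMatrix_X_pow :
    ((hasseMatrix κ y fun i : Fin (∑ q, κ q) => X ^ (i : ℕ)).submatrix id
      finSigmaFinEquiv.symm).det = ∏ j, ∏ k ∈ Finset.Ioi j, (y k - y j) ^ (κ j * κ k) := by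
  nontriviality R
  rw [← det_hasseMatrix_confluentNewton, ← Matrix.det_submatrix_equiv_self finSigmaFinEquiv.symm]
  have hdeg (i : Fin (∑ q, κ q)) :
      (confluentNewton κ y (finSigmaFinEquiv.symm i)).natDegree = i := by
    rw [confluentNewton_natDegree, Equiv.apply_symm_apply]
  have hmul := hasseMatrix_eq_mul κ y (fun i => confluentNewton κ y (finSigmaFinEquiv.symm i))
    fun i => (hdeg i).trans_lt i.2
  have hsub : (hasseMatrix κ y (confluentNewton κ y)).submatrix finSigmaFinEquiv.symm
      finSigmaFinEquiv.symm = (Matrix.of fun i j : Fin (∑ q, κ q) =>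
        (confluentNewton κ y (finSigmaFinEquiv.symm j)).coeff i).transpose *
        (hasseMatrix κ y fun i : Fin (∑ q, κ q) => X ^ (i : ℕ)).submatrix id
          finSigmaFinEquiv.symm :=
    congrArg (fun M => M.submatrix id finSigmaFinEquiv.symm) hmul
  rw [hsub, Matrix.det_mul, Matrix.det_transpose,
    Matrix.det_matrixOfPolynomials _ hdeg fun _ => confluentNewton_monic κ y _, one_mul]

theorem vanG_eq_submatrix_hasseMatrix :
    vanG R (∑ q, κ q) κ y (fun _ => 0) =
      ((hasseMatrix κ y fun i : Fin (∑ q, κ q) => X ^ (i : ℕ)).submatrix id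
        finSigmaFinEquiv.symm).submatrix Fin.revPerm id := by
  ext j p
  obtain ⟨s, rfl⟩ := finSigmaFinEquiv.surjective p
  simp only [vanG, hasseMatrix, Matrix.of_apply, Matrix.submatrix_apply, id, Fin.revPerm_apply,
    Equiv.symm_apply_apply, gammaPair_finSigmaFinEquiv, Fin.val_rev, taylor_X_pow,
    coeff_X_add_C_pow, add_zero]
  split_ifs with h
  · rw [mul_comm, Nat.sub_sub, add_right_comm _ 1]
  · rw [Nat.choose_eq_zero_of_lt (by have := s.1.2; omega), Nat.cast_zero, mul_zero]

end Newton

/-- `det G_∅(y,κ) = (−1)^{N(N−1)/2} ∏_{j<k} (y_k − y_j)^{κ_j κ_k}`. -/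
theorem confluent_vandermonde_det {R : Type*} [CommRing R]
    (n : ℕ) (hn : 1 ≤ n) (κ : Fin n → ℕ) (hκ : ∀ q, 0 < κ q)
    (N : ℕ) (hN : N = ∑ q, κ q) (y : Fin n → R) :
    (vanG R N κ y fun _ => 0).det =
      (-1 : R) ^ (N * (N - 1) / 2) *
        ∏ j, ∏ k ∈ Finset.Ioi j, (y k - y j) ^ (κ j * κ k) := by
  subst hN
  rw [vanG_eq_submatrix_hasseMatrix, Matrix.det_permute, det_hasseMatrix_X_pow, Fin.sign_revPerm]
  simp
end

section
/- Let R be a commutative ring, n ≥ 1, κ = (κ₁,…,κ_n) positive integers with N = κ₁+⋯+κ_n, y₁,…,y_n ∈ R, λ a partition of length ≤ N, and 1 ≤ r < s ≤ n. Let y' and κ' be obtained from y and κ by interchanging the r-th and s-th entries. Then det G_λ(y',κ') = (−1)^{(κ_r+κ_s)(κ_{r+1}+⋯+κ_{s−1}) + κ_r κ_s} · det G_λ(y,κ). -/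
open scoped BigOperators

/-- Evaluation of an alternating map in `N` variables on the first `N` entries of a list,
padded by zeros. -/
def AlternatingMap.evalList {R M P : Type*} [CommRing R] [AddCommGroup M] [Module R M]
    [AddCommGroup P] [Module R P] {N : ℕ} (f : M [⋀^Fin N]→ₗ[R] P) (l : List M) : P :=
  f fun p => l.getD p 0

section EvalList

variable {R M P : Type*} [CommRing R] [AddCommGroup M] [Module R M]
    [AddCommGroup P] [Module R P] {N : ℕ} (f : M [⋀^Fin N]→ₗ[R] P)

theorem AlternatingMap.evalList_swap (a e : List M) (x z : M) (h : a.length + 2 ≤ N) :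
    f.evalList (a ++ x :: z :: e) = -f.evalList (a ++ z :: x :: e) := by
  let i : Fin N := ⟨a.length, by omega⟩
  let k : Fin N := ⟨a.length + 1, by omega⟩
  have hik : i ≠ k := by simp [i, k]
  unfold AlternatingMap.evalList
  rw [← f.map_swap _ hik]
  congr 1
  funext p
  simp only [Function.comp_apply]
  rcases eq_or_ne p i with rfl | hi
  · rw [Equiv.swap_apply_left]
    simp [i, k]
  rcases eq_or_ne p k with rfl | hk
  · rw [Equiv.swap_apply_right]
    simp [i, k]
  rw [Equiv.swap_apply_of_ne_of_ne hi hk]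
  rcases lt_or_ge (p : ℕ) a.length with hp | hp
  · rw [List.getD_append _ _ _ _ hp, List.getD_append _ _ _ _ hp]
  · rw [List.getD_append_right _ _ _ _ hp, List.getD_append_right _ _ _ _ hp]
    obtain ⟨m, hm⟩ : ∃ m, (p : ℕ) - a.length = m + 2 := by
      refine ⟨p - a.length - 2, ?_⟩
      have h₁ : (p : ℕ) ≠ a.length := fun h => hi (Fin.ext h)
      have h₂ : (p : ℕ) ≠ a.length + 1 := fun h => hk (Fin.ext h)
      omega
    simp [hm]

theorem AlternatingMap.evalList_move (c : List M) (a e : List M) (x : M)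
    (h : a.length + c.length + 1 ≤ N) :
    f.evalList (a ++ x :: (c ++ e)) = (-1 : R) ^ c.length • f.evalList (a ++ c ++ x :: e) := by
  induction c generalizing a with
  | nil => simp
  | cons z c ih =>
    rw [List.length_cons] at h
    have key := ih (a ++ [z]) (by simp; omega)
    rw [List.cons_append, f.evalList_swap a (c ++ e) x z (by omega)]
    simp only [List.append_assoc, List.cons_append, List.nil_append] at key ⊢
    rw [key, List.length_cons, pow_succ, mul_neg_one, neg_smul]

theorem AlternatingMap.evalList_append_comm (a b c e : List M)
    (h : a.length + b.length + c.length ≤ N) :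
    f.evalList (a ++ b ++ c ++ e) =
      (-1 : R) ^ (b.length * c.length) • f.evalList (a ++ c ++ b ++ e) := by
  induction b generalizing a with
  | nil => simp
  | cons x b ih =>
    rw [List.length_cons] at h
    have h₁ := ih (a ++ [x]) (by simp; omega)
    have h₂ := f.evalList_move c a (b ++ e) x (by omega)
    simp only [List.append_assoc, List.cons_append, List.nil_append] at h₁ h₂ ⊢
    rw [h₁, h₂, smul_smul, ← pow_add, List.length_cons, add_mul, one_mul]

theorem AlternatingMap.evalList_exchange (a b m c e : List M)
    (h : a.length + b.length + m.length + c.length ≤ N) :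
    f.evalList (a ++ c ++ m ++ b ++ e) =
      (-1 : R) ^ ((b.length + c.length) * m.length + b.length * c.length) •
        f.evalList (a ++ b ++ m ++ c ++ e) := by
  have h₁ := f.evalList_append_comm a c (m ++ b) e (by simp; omega)
  have h₂ := f.evalList_append_comm a m b (c ++ e) (by omega)
  simp only [List.append_assoc] at h₁ h₂ ⊢
  rw [h₁, h₂, smul_smul, ← pow_add, List.length_append]
  congr 2
  ring

end EvalList

/-- The sorted list of `Fin n` split at two of its elements. -/
theorem List.exists_finRange_eq_append {n : ℕ} {r s : Fin n} (hrs : r < s) :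
    ∃ a m e : List (Fin n), List.finRange n = a ++ [r] ++ m ++ [s] ++ e ∧
      m.toFinset = Finset.Ioo r s := by
  obtain ⟨a, t, ht⟩ := List.append_of_mem (List.mem_finRange r)
  have hs := List.mem_finRange s
  have hlt := List.pairwise_lt_finRange n
  rw [ht] at hs hlt
  have hst : s ∈ t := by
    rcases List.mem_append.1 hs with h | h
    · exact absurd ((List.pairwise_append.1 hlt).2.2 s h r (by simp)) hrs.not_gt
    · exact (List.mem_cons.1 h).resolve_left hrs.ne'
  obtain ⟨m, e, rfl⟩ := List.append_of_mem hst
  refine ⟨a, m, e, by simp [ht], ?_⟩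
  ext x
  have hx := List.mem_finRange x
  rw [ht] at hx
  simp only [List.pairwise_append, List.pairwise_cons, List.mem_append, List.mem_cons] at hlt hx
  rw [List.mem_toFinset, Finset.mem_Ioo]
  grind

/-- The columns of the block of `vanG` attached to the value `a` with multiplicity `k`. -/
def vanGBlock {R : Type*} [CommRing R] {N : ℕ} (lam : Fin N → ℕ) (a : R) (k : ℕ) :
    List (Fin N → R) :=
  (List.range k).map fun r j =>
    if (j : ℕ) + r + 1 ≤ N + lam j then
      (Nat.choose (N + lam j - ((j : ℕ) + 1)) r : R) * a ^ (N + lam j - ((j : ℕ) + r + 1))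
    else 0

theorem length_vanGBlock {R : Type*} [CommRing R] {N : ℕ} (lam : Fin N → ℕ) (a : R) (k : ℕ) :
    (vanGBlock lam a k).length = k := by
  simp [vanGBlock]

theorem length_flatten_map_vanGBlock {R : Type*} [CommRing R] {n N : ℕ} (κ : Fin n → ℕ)
    (y : Fin n → R) (lam : Fin N → ℕ) (l : List (Fin n)) :
    ((l.map fun q => vanGBlock lam (y q) (κ q)).flatten).length = (l.map κ).sum := by
  simp [List.length_flatten, Function.comp_def, length_vanGBlock]

theorem det_vanG_eq_evalList {R : Type*} [CommRing R] {n N : ℕ} (κ : Fin n → ℕ)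
    (hN : N = ∑ q, κ q) (y : Fin n → R) (lam : Fin N → ℕ) :
    (vanG R N κ y lam).det = (Matrix.detRowAlternating (R := R) (n := Fin N)).evalList
      (((List.finRange n).map fun q => vanGBlock lam (y q) (κ q)).flatten) := by
  rw [← Matrix.det_transpose]
  unfold AlternatingMap.evalList
  change Matrix.detRowAlternating _ = _
  congr 1
  funext p j
  let g : ℕ × ℕ → Fin N → R := fun t j =>
    if h : t.1 < n ∧ (j : ℕ) + t.2 + 1 ≤ N + lam j then
      (Nat.choose (N + lam j - ((j : ℕ) + 1)) t.2 : R) *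
        y ⟨t.1, h.1⟩ ^ (N + lam j - ((j : ℕ) + t.2 + 1))
    else 0
  have hmap : ((List.finRange n).map fun q => vanGBlock lam (y q) (κ q)).flatten =
      ((List.ofFn fun q : Fin n =>
        (List.range (κ q)).map fun r => ((q : ℕ), r)).flatten).map g := by
    rw [List.map_flatten, List.ofFn_eq_map, List.map_map]
    congr 1
    refine List.map_congr_left fun q _ => ?_
    simp only [Function.comp_apply, List.map_map, vanGBlock]
    refine List.map_congr_left fun t _ => ?_
    funext j
    simp [g]
  have hlen : ((List.finRange n).map fun q => vanGBlock lam (y q) (κ q)).flatten.length = N := by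
    rw [length_flatten_map_vanGBlock, hN, ← List.ofFn_eq_map, List.sum_ofFn]
  rw [hmap] at hlen ⊢
  have hp : (p : ℕ) < (List.ofFn fun q : Fin n =>
      (List.range (κ q)).map fun r => ((q : ℕ), r)).flatten.length := by
    rw [List.length_map] at hlen
    omega
  rw [List.getD_eq_getElem _ _ (by rw [List.length_map]; exact hp), List.getElem_map,
    ← List.getD_eq_getElem _ (0, 0) hp]
  rfl

/-- interchanging the blocks `y_r^{[κ_r]}` and `y_s^{[κ_s]}` multiplies
`det G_λ` by `(−1)^{(κ_r+κ_s)(κ_{r+1}+⋯+κ_{s−1}) + κ_r κ_s}`. -/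
theorem vanG_det_swap {R : Type*} [CommRing R]
    (n : ℕ) (hn : 1 ≤ n) (κ : Fin n → ℕ) (hκ : ∀ q, 0 < κ q)
    (N : ℕ) (hN : N = ∑ q, κ q) (y : Fin n → R)
    (lam : Fin N → ℕ) (hlam : Antitone lam)
    (r s : Fin n) (hrs : r < s) :
    (vanG R N (κ ∘ Equiv.swap r s) (y ∘ Equiv.swap r s) lam).det =
      (-1 : R) ^ ((κ r + κ s) * (∑ j ∈ Finset.Ioo r s, κ j) + κ r * κ s) *
        (vanG R N κ y lam).det := by
  have hN' : N = ∑ q, (κ ∘ Equiv.swap r s) q := by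
    rw [hN]
    exact (Equiv.sum_comp (Equiv.swap r s) κ).symm
  rw [det_vanG_eq_evalList κ hN, det_vanG_eq_evalList _ hN']
  obtain ⟨a, m, e, hl, hm⟩ := List.exists_finRange_eq_append hrs
  have hnd := List.nodup_finRange n
  have hsum : (List.map κ (List.finRange n)).sum = N := by
    rw [hN, ← List.ofFn_eq_map, List.sum_ofFn]
  rw [hl] at hnd hsum ⊢
  have hfix : ∀ l : List (Fin n), r ∉ l → s ∉ l →
      (l.map fun q => vanGBlock lam ((y ∘ Equiv.swap r s) q) ((κ ∘ Equiv.swap r s) q)) =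
        l.map fun q => vanGBlock lam (y q) (κ q) := fun l hr hs =>
    List.map_congr_left fun q hq => by
      simp only [Function.comp_apply]
      rw [Equiv.swap_apply_of_ne_of_ne (ne_of_mem_of_not_mem hq hr) (ne_of_mem_of_not_mem hq hs)]
  have hmsum : (m.map κ).sum = ∑ j ∈ Finset.Ioo r s, κ j := by
    rw [← hm, List.sum_toFinset _ (by grind)]
  have hex := (Matrix.detRowAlternating (R := R) (n := Fin N)).evalList_exchange
    (a.map fun q => vanGBlock lam (y q) (κ q)).flatten (vanGBlock lam (y r) (κ r))
    (m.map fun q => vanGBlock lam (y q) (κ q)).flatten (vanGBlock lam (y s) (κ s))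
    (e.map fun q => vanGBlock lam (y q) (κ q)).flatten (by
      simp only [length_flatten_map_vanGBlock, length_vanGBlock]
      simp at hsum
      omega)
  rw [length_flatten_map_vanGBlock, length_vanGBlock, length_vanGBlock, hmsum, smul_eq_mul] at hex
  simp only [List.map_append, List.flatten_append, hfix a (by grind) (by grind),
    hfix m (by grind) (by grind), hfix e (by grind) (by grind)]
  simpa using hex
end
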